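/- Let W be a symmetric and nonsingular discrete memoryless channel with R_cr < C(W). Then for any rate R with R_∞ < R < C(W) there exists a constant K̃₁ > 0 (depending only on W and R) such that for every blocklength N ∈ ℤ⁺, the minimum average error probability of codes with ideal feedback satisfies P̄_{e,fb}(N,R) ≥ K̃₁ · N^{−(1+|E_SP′(R)|)/2} · exp(−N·E_SP(R)), where E_SP′(R) is the derivative of E_SP at R. -/

import Mathlib

open Real Finset

variable {X Y : Type} [Fintype X] [Fintype Y]

/-- A discrete memoryless channel: `W x y` is the probability of output `y` given input `x`. -/
def IsDMC (W : X → Y → ℝ) : Prop :=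
  (∀ x y, 0 ≤ W x y) ∧ ∀ x, ∑ y, W x y = 1

/-- A probability distribution on a finite alphabet. -/
def IsProbDist (Q : X → ℝ) : Prop :=
  (∀ x, 0 ≤ Q x) ∧ ∑ x, Q x = 1

/-- Gallager symmetry: the output alphabet can be partitioned into classes such that within
each class every row is a permutation of every other row, and every column is a permutation
of every other column. -/
def GallagerSymmetric (W : X → Y → ℝ) : Prop :=
  ∃ cls : Y → ℕ,
    (∀ (l : ℕ) (x x' : X),
        ((Finset.univ.filter fun y => cls y = l).val.map fun y => W x y) =
        ((Finset.univ.filter fun y => cls y = l).val.map fun y => W x' y)) ∧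
    (∀ y y' : Y, cls y = cls y' →
        (Finset.univ.val.map fun x => W x y) = (Finset.univ.val.map fun x => W x y'))

/-- Singularity: whenever two inputs both give an output positive probability,
they give it the same probability. -/
def Singular (W : X → Y → ℝ) : Prop :=
  ∀ x z y, 0 < W x y * W z y → W x y = W z y

/-- Gallager's function `E_o(ρ, Q)`. -/
noncomputable def Eo (W : X → Y → ℝ) (Q : X → ℝ) (ρ : ℝ) : ℝ :=
  - Real.log (∑ y, (∑ x, Q x * W x y ^ (1 / (1 + ρ))) ^ (1 + ρ))

/-- Mutual information `I(Q; W)`. -/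
noncomputable def mutualInfo (W : X → Y → ℝ) (Q : X → ℝ) : ℝ :=
  ∑ x, ∑ y, Q x * W x y * Real.log (W x y / ∑ z, Q z * W z y)

/-- Channel capacity `C(W)`. -/
noncomputable def capacity (W : X → Y → ℝ) : ℝ :=
  sSup {r | ∃ Q, IsProbDist Q ∧ r = mutualInfo W Q}

/-- The set of values whose supremum is the sphere-packing exponent. -/
def ESPset (W : X → Y → ℝ) (R : ℝ) : Set ℝ :=
  {e | ∃ Q, IsProbDist Q ∧ ∃ ρ : ℝ, 0 ≤ ρ ∧ e = Eo W Q ρ - ρ * R}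

/-- The sphere-packing exponent `E_SP(R) = max_Q sup_{ρ ≥ 0} (E_o(ρ,Q) - ρ R)`. -/
noncomputable def ESP (W : X → Y → ℝ) (R : ℝ) : ℝ := sSup (ESPset W R)

/-- The random coding exponent `E_r(R) = max_Q max_{0 ≤ ρ ≤ 1} (E_o(ρ,Q) - ρ R)`. -/
noncomputable def Er (W : X → Y → ℝ) (R : ℝ) : ℝ :=
  sSup {e | ∃ Q, IsProbDist Q ∧ ∃ ρ : ℝ, 0 ≤ ρ ∧ ρ ≤ 1 ∧ e = Eo W Q ρ - ρ * R}

/-- `R_∞`: the supremum of rates at which the sphere-packing exponent is infinite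
(i.e. the defining supremum is unbounded). -/
noncomputable def Rinf (W : X → Y → ℝ) : ℝ :=
  sSup {R | ¬ BddAbove (ESPset W R)}

/-- The critical rate `R_cr`: the smallest rate above which `E_r = E_SP`. -/
noncomputable def Rcr (W : X → Y → ℝ) : ℝ :=
  sInf {R | ∀ R', R ≤ R' → Er W R' = ESP W R'}

/-- Number of messages of an `(N, R)` code: `⌈e^{NR}⌉`. -/
noncomputable def Mof (N : ℕ) (R : ℝ) : ℕ := ⌈Real.exp (N * R)⌉₊

/-- Error probability of message `m` for a (non-feedback) block code. -/
noncomputable def msgErrorProb (W : X → Y → ℝ) {N M : ℕ}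
    (f : Fin M → Fin N → X) (φ : (Fin N → Y) → Fin M) (m : Fin M) : ℝ :=
  ∑ y ∈ Finset.univ.filter (fun y : Fin N → Y => φ y ≠ m), ∏ n, W (f m n) (y n)

/-- Average error probability of a (non-feedback) block code. -/
noncomputable def avgErrorProb (W : X → Y → ℝ) {N M : ℕ}
    (f : Fin M → Fin N → X) (φ : (Fin N → Y) → Fin M) : ℝ :=
  (M : ℝ)⁻¹ * ∑ m, msgErrorProb W f φ m

/-- A feedback encoder, given as a function of the whole output word, is causal if the symbol
sent at time `n` depends only on the message and the outputs at times `< n`. -/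
def Causal {N M : ℕ} (f : Fin M → (Fin N → Y) → Fin N → X) : Prop :=
  ∀ m y y' n, (∀ k, k < n → y k = y' k) → f m y n = f m y' n

/-- Average error probability of a feedback code. -/
noncomputable def avgErrorProbFb (W : X → Y → ℝ) {N M : ℕ}
    (f : Fin M → (Fin N → Y) → Fin N → X) (φ : (Fin N → Y) → Fin M) : ℝ :=
  (M : ℝ)⁻¹ * ∑ m, ∑ y ∈ Finset.univ.filter (fun y : Fin N → Y => φ y ≠ m),
      ∏ n, W (f m y n) (y n)

section ProductWeights

/-- Pushing product weights forward along a map of alphabets. -/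
theorem sum_prod_pushforward {A B : Type*} [Fintype A] [Fintype B] [DecidableEq B]
    (u : A → ℝ) (g : A → B) (v : B → ℝ) (hv : ∀ b, v b = ∑ a with g a = b, u a)
    (N : ℕ) (H : (Fin N → B) → ℝ) :
    ∑ y : Fin N → B, (∏ n, v (y n)) * H y =
      ∑ a : Fin N → A, (∏ n, u (a n)) * H (fun n => g (a n)) := by
  classical
  rw [← Finset.sum_fiberwise (s := (univ : Finset (Fin N → A)))
    (g := fun a n => g (a n))]
  refine Finset.sum_congr rfl fun y _ => ?_
  simp_rw [hv]
  rw [Finset.prod_univ_sum, Finset.sum_mul]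
  refine Finset.sum_congr ?_ ?_
  · ext a
    simp [Fintype.mem_piFinset, funext_iff]
  · intro a ha
    have : (fun n => g (a n)) = y := by
      simpa [funext_iff] using ha
    rw [this]

theorem sum_prod_weights {A : Type*} [Fintype A] (v : A → ℝ) (N : ℕ) :
    ∑ y : Fin N → A, ∏ n, v (y n) = (∑ a, v a) ^ N := by
  classical
  rw [← Fintype.prod_sum fun (_ : Fin N) a => v a]
  simp

theorem sum_prod_weights_succ {A : Type*} [Fintype A] (v : A → ℝ) (N : ℕ)
    (H : (Fin (N + 1) → A) → ℝ) :
    ∑ y : Fin (N + 1) → A, (∏ n, v (y n)) * H y =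
      ∑ a, v a * ∑ y : Fin N → A, (∏ n, v (y n)) * H (Fin.cons a y) := by
  rw [← (Fin.consEquiv fun _ => A).sum_comp, Fintype.sum_prod_type]
  refine Finset.sum_congr rfl fun a _ => ?_
  rw [Finset.mul_sum]
  refine Finset.sum_congr rfl fun y _ => ?_
  simp [Fin.consEquiv, Fin.prod_univ_succ, mul_assoc]

theorem sum_prod_weights_mul_sum {A : Type*} [Fintype A] (v g : A → ℝ)
    (hv : ∑ a, v a = 1) (hg : ∑ a, v a * g a = 0) (N : ℕ) :
    ∑ y : Fin N → A, (∏ n, v (y n)) * ∑ n, g (y n) = 0 := by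
  induction N with
  | zero => simp
  | succ N ih =>
    rw [sum_prod_weights_succ]
    simp only [Fin.sum_univ_succ, Fin.cons_zero, Fin.cons_succ, mul_add, Finset.sum_add_distrib,
      ← Finset.sum_mul, sum_prod_weights, hv, ih]
    simpa using hg

/-- The variance of a sum of independent centred variables. -/
theorem sum_prod_weights_mul_sum_sq {A : Type*} [Fintype A] (v g : A → ℝ)
    (hv : ∑ a, v a = 1) (hg : ∑ a, v a * g a = 0) (N : ℕ) :
    ∑ y : Fin N → A, (∏ n, v (y n)) * (∑ n, g (y n)) ^ 2 = N * ∑ a, v a * g a ^ 2 := by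
  induction N with
  | zero => simp
  | succ N ih =>
    rw [sum_prod_weights_succ]
    have key : ∀ a, ∑ y : Fin N → A, (∏ n, v (y n)) *
        (∑ n, g ((Fin.cons a y : Fin (N + 1) → A) n)) ^ 2 =
        g a ^ 2 + N * ∑ a, v a * g a ^ 2 := by
      intro a
      have h1 := sum_prod_weights v N
      have h2 := sum_prod_weights_mul_sum v g hv hg N
      rw [hv, one_pow] at h1
      have : ∀ y : Fin N → A, (∏ n, v (y n)) *
          (∑ n, g ((Fin.cons a y : Fin (N + 1) → A) n)) ^ 2 =
          g a ^ 2 * (∏ n, v (y n)) + 2 * g a * ((∏ n, v (y n)) * ∑ n, g (y n)) +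
            (∏ n, v (y n)) * (∑ n, g (y n)) ^ 2 := by
        intro y
        simp only [Fin.sum_univ_succ, Fin.cons_zero, Fin.cons_succ]
        ring
      simp_rw [this, Finset.sum_add_distrib, ← Finset.mul_sum, h1, h2, ih]
      ring
    simp_rw [key, mul_add, Finset.sum_add_distrib, ← Finset.sum_mul, hv]
    push_cast
    ring

end ProductWeights

section Binomial

theorem four_pow_sq_le_centralBinom (m : ℕ) (hm : 0 < m) :
    ((4 : ℝ) ^ m) ^ 2 ≤ 4 * m * (Nat.centralBinom m : ℝ) ^ 2 := by
  induction m, hm using Nat.le_induction with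
  | base => norm_num [Nat.centralBinom, Nat.choose]
  | succ m hm ih =>
    have h := Nat.succ_mul_centralBinom_succ m
    have h' : ((m : ℝ) + 1) * Nat.centralBinom (m + 1) = 2 * (2 * m + 1) * Nat.centralBinom m := by
      exact_mod_cast h
    have hm' : (1 : ℝ) ≤ m := by exact_mod_cast hm
    have e : (Nat.centralBinom (m + 1) : ℝ) = 2 * (2 * m + 1) * Nat.centralBinom m / (m + 1) := by
      field_simp
      linarith
    rw [e, pow_succ (4 : ℝ) m, mul_pow]
    push_cast
    have : 4 * ((m : ℝ) + 1) * (2 * (2 * m + 1) * Nat.centralBinom m / (m + 1)) ^ 2 =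
        (4 * m * (Nat.centralBinom m : ℝ) ^ 2) * (4 * (2 * m + 1) ^ 2 / (m * (m + 1))) := by
      field_simp
      ring
    rw [this]
    refine mul_le_mul ih ?_ (by positivity) (by positivity)
    rw [le_div_iff₀ (by positivity)]
    nlinarith

/-- Comparison of a binomial coefficient near the centre with the central one. -/
theorem centralBinom_le_pow_mul_choose (m i : ℕ) (hi : i ≤ m) :
    (Nat.centralBinom m : ℝ) * (m - i : ℝ) ^ i ≤ (m + i : ℝ) ^ i * (Nat.choose (2 * m) (m + i)) := by
  have hi' : (i : ℝ) ≤ m := by exact_mod_cast hi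
  have key : ∀ k, k ≤ i → (Nat.centralBinom m : ℝ) * (m - i : ℝ) ^ k ≤
      (m + i : ℝ) ^ k * (Nat.choose (2 * m) (m + k)) := by
    intro k
    induction k with
    | zero => simp [Nat.centralBinom]
    | succ k ih =>
      intro hk
      have hk' : (k : ℝ) + 1 ≤ i := by exact_mod_cast hk
      have ih := ih (by omega)
      have h := Nat.choose_succ_right_eq (2 * m) (m + k)
      have h' : (Nat.choose (2 * m) (m + (k + 1)) : ℝ) * (m + k + 1) =
          Nat.choose (2 * m) (m + k) * (m - k) := by
        have e : 2 * m - (m + k) = m - k := by omega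
        rw [e] at h
        have := congrArg (Nat.cast : ℕ → ℝ) h
        push_cast [Nat.cast_sub (show k ≤ m by omega)] at this
        rw [← add_assoc]
        linarith
      have hc : (0 : ℝ) ≤ Nat.choose (2 * m) (m + k) := by positivity
      have hc' : (0 : ℝ) ≤ Nat.choose (2 * m) (m + (k + 1)) := by positivity
      calc (Nat.centralBinom m : ℝ) * (m - i : ℝ) ^ (k + 1)
          = (Nat.centralBinom m : ℝ) * (m - i : ℝ) ^ k * (m - i) := by ring
        _ ≤ (m + i : ℝ) ^ k * (Nat.choose (2 * m) (m + k)) * (m - i) :=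
            mul_le_mul_of_nonneg_right ih (by linarith)
        _ = (m + i : ℝ) ^ k * ((Nat.choose (2 * m) (m + k)) * (m - i)) := by ring
        _ ≤ (m + i : ℝ) ^ k * ((Nat.choose (2 * m) (m + (k + 1))) * (m + i)) := by
            refine mul_le_mul_of_nonneg_left ?_ (by positivity)
            nlinarith
        _ = _ := by ring
  exact key i le_rfl

theorem centralBinom_le_exp_mul_choose (m i : ℕ) (hi : 2 * i ≤ m) :
    (Nat.centralBinom m : ℝ) * Real.exp (-(4 * i ^ 2 / m)) ≤ Nat.choose (2 * m) (m + i) := by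
  rcases Nat.eq_zero_or_pos m with rfl | hm
  · obtain rfl : i = 0 := by omega
    simp
  have hi' : 2 * (i : ℝ) ≤ m := by exact_mod_cast hi
  have hm' : (0 : ℝ) < m := by exact_mod_cast hm
  have hpos : (0 : ℝ) < m - i := by
    have : (0 : ℝ) ≤ i := by positivity
    linarith
  have h := centralBinom_le_pow_mul_choose m i (by omega)
  have h1 : ((m + i : ℝ)) ^ i ≤ (m - i : ℝ) ^ i * Real.exp (4 * i ^ 2 / m) := by
    have : (m + i : ℝ) ≤ (m - i) * Real.exp (4 * i / m) := by
      have e := Real.add_one_le_exp (4 * (i : ℝ) / m)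
      refine le_trans ?_ (mul_le_mul_of_nonneg_left e hpos.le)
      have : (m - i : ℝ) * (4 * i / m + 1) = (m + i) + 2 * i * (m - 2 * i) / m := by
        field_simp
        ring
      rw [this]
      have : 0 ≤ 2 * (i : ℝ) * (m - 2 * i) / m := by
        apply div_nonneg _ hm'.le
        apply mul_nonneg (by positivity)
        linarith
      linarith
    calc ((m + i : ℝ)) ^ i ≤ ((m - i) * Real.exp (4 * i / m)) ^ i := by gcongr
      _ = _ := by
        rw [mul_pow, ← Real.exp_nat_mul]
        congr 2
        ring
  have h2 : (Nat.centralBinom m : ℝ) * (m - i : ℝ) ^ i ≤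
      (m - i : ℝ) ^ i * Real.exp (4 * i ^ 2 / m) * (Nat.choose (2 * m) (m + i)) :=
    h.trans (mul_le_mul_of_nonneg_right h1 (by positivity))
  have h3 : (Nat.centralBinom m : ℝ) ≤ Real.exp (4 * i ^ 2 / m) * (Nat.choose (2 * m) (m + i)) := by
    have : (0 : ℝ) < (m - i : ℝ) ^ i := by positivity
    refine le_of_mul_le_mul_right ?_ this
    linarith
  rw [Real.exp_neg, ← div_eq_mul_inv, div_le_iff₀ (Real.exp_pos _)]
  linarith

theorem choose_lower_bound_of_le {n j m i : ℕ} {C : ℝ} (hC : 0 < C)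
    (hm1 : 2 * m ≤ n) (hm2 : n ≤ 2 * m + 1) (hj : j = m + i ∨ j + i = m)
    (hi : (i : ℝ) ≤ C * √n) (hn : 64 * C ^ 2 + 2 ≤ n) :
    Real.exp (-(16 * C ^ 2)) / 4 / √n * 2 ^ n ≤ Nat.choose n j := by
  have hn0 : (0 : ℝ) < n := by nlinarith
  have hs : 0 < √(n : ℝ) := Real.sqrt_pos.2 hn0
  have hss : √(n : ℝ) ^ 2 = n := Real.sq_sqrt hn0.le
  have hm1' : 2 * (m : ℝ) ≤ n := by exact_mod_cast hm1
  have hm2' : (n : ℝ) ≤ 2 * m + 1 := by exact_mod_cast hm2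
  have hmn : (n : ℝ) ≤ 4 * m := by nlinarith
  have hm0 : (0 : ℝ) < m := by linarith
  have h8 : 8 * C ≤ √(n : ℝ) := Real.le_sqrt_of_sq_le (by nlinarith)
  have him : 2 * i ≤ m := by
    have : 2 * (i : ℝ) ≤ m := by nlinarith
    exact_mod_cast this
  have hch : Nat.choose (2 * m) (m + i) ≤ Nat.choose n j := by
    have e : Nat.choose (2 * m) (m + i) = Nat.choose (2 * m) j := by
      rcases hj with rfl | hj
      · rfl
      · rw [← Nat.choose_symm (show m + i ≤ 2 * m by omega)]
        congr 1
        omega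
    rw [e]
    exact Nat.choose_le_choose j hm1
  have hch' : (Nat.choose (2 * m) (m + i) : ℝ) ≤ Nat.choose n j := by exact_mod_cast hch
  refine le_trans ?_ ((centralBinom_le_exp_mul_choose m i him).trans hch')
  have hexp : Real.exp (-(16 * C ^ 2)) ≤ Real.exp (-(4 * i ^ 2 / m)) := by
    apply Real.exp_le_exp.2
    rw [neg_le_neg_iff, div_le_iff₀ hm0]
    have : (i : ℝ) ^ 2 ≤ C ^ 2 * n := by
      rw [← hss, ← mul_pow]
      gcongr
    nlinarith [sq_nonneg C]
  have hcb : 2 ^ n / (4 * √(n : ℝ)) ≤ (Nat.centralBinom m : ℝ) := by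
    have h := four_pow_sq_le_centralBinom m (by exact_mod_cast hm0)
    have h2 : (4 : ℝ) ^ m ≤ 2 * √(n : ℝ) * Nat.centralBinom m := by
      refine le_of_sq_le_sq ?_ (by positivity)
      rw [mul_pow, mul_pow, hss]
      refine h.trans ?_
      gcongr
      · norm_num
      · omega
    have h3 : (2 : ℝ) ^ n ≤ 2 * 4 ^ m := by
      calc (2 : ℝ) ^ n ≤ 2 ^ (2 * m + 1) := pow_le_pow_right₀ (by norm_num) hm2
        _ = 2 * 4 ^ m := by rw [pow_succ, pow_mul]; norm_num; ring
    rw [div_le_iff₀ (by positivity)]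
    linarith
  calc Real.exp (-(16 * C ^ 2)) / 4 / √n * 2 ^ n
      = 2 ^ n / (4 * √(n : ℝ)) * Real.exp (-(16 * C ^ 2)) := by field_simp
    _ ≤ _ := by gcongr

/-- Binomial probabilities within order `√n` of the centre are of order at least `1 / √n`. -/
theorem choose_lower_bound {n j : ℕ} {C : ℝ} (hC : 0 ≤ C)
    (hj : |(j : ℝ) - n / 2| ≤ C * √n) (hn : 64 * (C + 1) ^ 2 + 2 ≤ n) :
    Real.exp (-(16 * (C + 1) ^ 2)) / 4 / √n * 2 ^ n ≤ Nat.choose n j := by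
  have hn1 : (1 : ℝ) ≤ n := by nlinarith
  have hs : 1 ≤ √(n : ℝ) := Real.one_le_sqrt.2 hn1
  have hm1' : 2 * ((n / 2 : ℕ) : ℝ) ≤ n := by exact_mod_cast (show 2 * (n / 2) ≤ n by omega)
  have hm2' : (n : ℝ) ≤ 2 * ((n / 2 : ℕ) : ℝ) + 1 := by
    exact_mod_cast (show n ≤ 2 * (n / 2) + 1 by omega)
  obtain ⟨h1, h2⟩ := abs_le.1 hj
  rcases le_total (n / 2) j with h | h
  · refine choose_lower_bound_of_le (m := n / 2) (i := j - n / 2) (by linarith) (by omega)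
      (by omega) (Or.inl (by omega)) ?_ hn
    rw [Nat.cast_sub h]
    linarith
  · refine choose_lower_bound_of_le (m := n / 2) (i := n / 2 - j) (by linarith) (by omega)
      (by omega) (Or.inr (by omega)) ?_ hn
    rw [Nat.cast_sub h]
    linarith

/-- A family of independent fair coins indexed by `ι`, of which those in `A` are counted. -/
theorem choose_mul_two_pow_le_card {ι : Type*} [Fintype ι] [DecidableEq ι] (A : Finset ι) (j : ℕ) :
    Nat.choose #A j * 2 ^ #Aᶜ ≤ #{ε : ι → Bool | #{i ∈ A | ε i = true} = j} := by
  rw [← Finset.card_powersetCard, ← Finset.card_powerset, ← Finset.card_product]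
  refine Finset.card_le_card_of_injOn (fun p i => decide (i ∈ p.1 ∪ p.2)) ?_ ?_
  · rintro ⟨S, T⟩ h
    simp only [Finset.coe_product, Set.mem_prod, Finset.mem_coe, Finset.mem_powersetCard,
      Finset.mem_powerset] at h
    obtain ⟨⟨hS, rfl⟩, hT⟩ := h
    simp only [Finset.coe_filter, Finset.mem_univ, true_and, Set.mem_ofPred_eq, decide_eq_true_eq]
    congr 1
    ext i
    have := @hT i
    have := @hS i
    simp only [Finset.mem_filter, Finset.mem_union, Finset.mem_compl] at *
    tauto
  · rintro ⟨S, T⟩ h ⟨S', T'⟩ h' e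
    simp only [Finset.coe_product, Set.mem_prod, Finset.mem_coe, Finset.mem_powersetCard,
      Finset.mem_powerset] at h h'
    have e' : ∀ i, (i ∈ S ∨ i ∈ T) ↔ (i ∈ S' ∨ i ∈ T') := by
      intro i
      simpa only [decide_eq_decide, Finset.mem_union] using congrFun e i
    ext i
    all_goals
      have h1 := @h.1.1 i
      have h2 := @h.2 i
      have h3 := @h'.1.1 i
      have h4 := @h'.2 i
      have h5 := e' i
      simp only [Finset.mem_compl] at *
      tauto

end Binomial

section LocalLimit

/-- Among all outcomes of `N` fair coins, a non-negligible fraction puts a weighted count of heads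
over a large set of positions into a prescribed window of length `δ`. -/
theorem coin_window_lower_bound {N : ℕ} (A : Finset (Fin N)) {U δ t θ D : ℝ} (hδ : 0 < δ)
    (hθ : 0 < θ) (hD : 1 ≤ D) (ht : |t - (U + δ * #A / 2)| ≤ δ * (D - 1) * √N)
    (hA : θ * N ≤ #A) (hN : 64 * (D / √θ + 1) ^ 2 + 2 ≤ θ * N) :
    Real.exp (-(16 * (D / √θ + 1) ^ 2)) / 4 / √N * 2 ^ N ≤
      #{ε : Fin N → Bool | t - δ ≤ U + δ * #{i ∈ A | ε i = true} ∧
        U + δ * #{i ∈ A | ε i = true} ≤ t} := by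
  have hAN : #A ≤ N := by simpa using Finset.card_le_univ A
  have hAN' : (#A : ℝ) ≤ N := by exact_mod_cast hAN
  have hsθ : 0 < √θ := Real.sqrt_pos.2 hθ
  set C := D / √θ with hC
  have hC0 : 0 ≤ C := by positivity
  have hn1 : 64 * (C + 1) ^ 2 + 2 ≤ (#A : ℝ) := hN.trans hA
  have hn0 : (0 : ℝ) < #A := by nlinarith
  have hN1 : (1 : ℝ) ≤ N := by nlinarith
  have hsN : 1 ≤ √(N : ℝ) := Real.one_le_sqrt.2 hN1
  have hsn : √(#A : ℝ) ^ 2 = #A := Real.sq_sqrt hn0.le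
  have hsn0 : 0 < √(#A : ℝ) := Real.sqrt_pos.2 hn0
  have hDC : D * √(N : ℝ) ≤ C * √(#A : ℝ) := by
    have h : √θ * √(N : ℝ) ≤ √(#A : ℝ) := by
      rw [← Real.sqrt_mul hθ.le]
      exact Real.sqrt_le_sqrt hA
    calc D * √(N : ℝ) = C * (√θ * √(N : ℝ)) := by rw [hC]; field_simp
      _ ≤ _ := by gcongr
  set x := (t - U) / δ with hx
  have hxt : U + δ * x = t := by rw [hx]; field_simp; ring
  have hxn : |x - #A / 2| ≤ (D - 1) * √(N : ℝ) := by
    have e : x - #A / 2 = (t - (U + δ * #A / 2)) / δ := by rw [hx]; field_simp; ring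
    rw [e, abs_div, abs_of_pos hδ, div_le_iff₀ hδ]
    linarith
  obtain ⟨hx1, hx2⟩ := abs_le.1 hxn
  have h2C : 2 * C ≤ √(#A : ℝ) := Real.le_sqrt_of_sq_le (by nlinarith)
  have hx0 : 0 ≤ x := by
    have : C * √(#A : ℝ) ≤ #A / 2 := by nlinarith
    nlinarith
  have hj1 := Nat.floor_le hx0
  have hj2 := Nat.lt_floor_add_one x
  have hj : |(⌊x⌋₊ : ℝ) - (#A : ℝ) / 2| ≤ C * √(#A : ℝ) := by
    rw [abs_le]
    constructor <;> nlinarith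
  have hch := choose_lower_bound hC0 hj hn1
  have hcard := choose_mul_two_pow_le_card A ⌊x⌋₊
  have hsub : #{ε : Fin N → Bool | #{i ∈ A | ε i = true} = ⌊x⌋₊} ≤
      #{ε : Fin N → Bool | t - δ ≤ U + δ * #{i ∈ A | ε i = true} ∧
        U + δ * #{i ∈ A | ε i = true} ≤ t} := by
    refine Finset.card_le_card ?_
    intro ε hε
    simp only [Finset.mem_filter, Finset.mem_univ, true_and] at hε ⊢
    rw [hε]
    constructor <;> nlinarith
  have hall : (Nat.choose #A ⌊x⌋₊ : ℝ) * 2 ^ #Aᶜ ≤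
      #{ε : Fin N → Bool | t - δ ≤ U + δ * #{i ∈ A | ε i = true} ∧
        U + δ * #{i ∈ A | ε i = true} ≤ t} := by
    exact_mod_cast hcard.trans hsub
  refine le_trans ?_ hall
  have hpow : (2 : ℝ) ^ N = 2 ^ #A * 2 ^ #Aᶜ := by
    rw [← pow_add, Finset.card_add_card_compl]
    simp
  rw [hpow, ← mul_assoc]
  refine mul_le_mul_of_nonneg_right (le_trans ?_ hch) (by positivity)
  gcongr

theorem sum_prod_weights_mul_one_sub {A : Type*} [Fintype A] (v g h : A → ℝ)
    (hv : ∑ a, v a = 1) (hg : ∑ a, v a * g a = 0) (hh : ∑ a, v a * h a = 0) (N : ℕ)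
    (K a b : ℝ) :
    ∑ y : Fin N → A, (∏ n, v (y n)) *
        (K * (1 - ((∑ n, g (y n)) ^ 2 / a + (∑ n, h (y n)) ^ 2 / b))) =
      K * (1 - (N * (∑ i, v i * g i ^ 2) / a + N * (∑ i, v i * h i ^ 2) / b)) := by
  have e : ∀ y : Fin N → A, (∏ n, v (y n)) *
      (K * (1 - ((∑ n, g (y n)) ^ 2 / a + (∑ n, h (y n)) ^ 2 / b))) =
      K * (∏ n, v (y n)) - K / a * ((∏ n, v (y n)) * (∑ n, g (y n)) ^ 2) -
        K / b * ((∏ n, v (y n)) * (∑ n, h (y n)) ^ 2) := by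
    intro y
    ring
  simp only [e, Finset.sum_sub_distrib, ← Finset.mul_sum]
  rw [sum_prod_weights_mul_sum_sq v g hv hg, sum_prod_weights_mul_sum_sq v h hv hh,
    sum_prod_weights, hv]
  ring

variable {Y : Type*} [Fintype Y]

/-- Local lower bound for the law of a sum of i.i.d. centred variables on a finite alphabet: any
window whose length is the distance of two atoms, placed within the range of the central
limit theorem, has probability at least of order `1 / √N`. -/
theorem local_limit_lower_bound (v s : Y → ℝ) (hv0 : ∀ y, 0 ≤ v y) (hv : ∑ y, v y = 1)
    (hs : ∑ y, v y * s y = 0) {y₁ y₂ : Y} (h₁ : 0 < v y₁) (h₂ : 0 < v y₂) (h₁₂ : s y₁ < s y₂) :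
    ∃ k : ℝ, 0 < k ∧ ∃ N₀ : ℕ, ∀ N : ℕ, N₀ ≤ N → ∀ t : ℝ, |t| ≤ √N →
      k / √N ≤ ∑ y : Fin N → Y with t - (s y₂ - s y₁) ≤ ∑ n, s (y n) ∧ ∑ n, s (y n) ≤ t,
        ∏ n, v (y n) := by
  classical
  obtain ⟨θ, hθ, hθ₁, hθ₂⟩ : ∃ θ, 0 < θ ∧ θ ≤ v y₁ ∧ θ ≤ v y₂ :=
    ⟨min (v y₁) (v y₂), lt_min h₁ h₂, min_le_left _ _, min_le_right _ _⟩
  set δ := s y₂ - s y₁ with hδdef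
  have hδ : 0 < δ := sub_pos.2 h₁₂
  have hy : y₁ ≠ y₂ := by
    rintro rfl
    exact lt_irrefl _ h₁₂
  let z : Option Y × Bool → Y := fun a => a.1.elim (if a.2 then y₂ else y₁) id
  let w : Option Y → ℝ := fun l =>
    l.elim (2 * θ) fun y => v y - (if y = y₁ then θ else 0) - (if y = y₂ then θ else 0)
  let g : Option Y → ℝ := fun l => l.elim ((s y₁ + s y₂) / 2) s
  let h : Option Y → ℝ := fun l => l.elim (1 - 2 * θ) fun _ => -(2 * θ)
  have hw0 : ∀ l, 0 ≤ w l := by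
    rintro (_ | y)
    · simp only [w, Option.elim]
      positivity
    · simp only [w, Option.elim]
      by_cases e₁ : y = y₁
      · subst e₁
        simpa [hy] using hθ₁
      · by_cases e₂ : y = y₂
        · subst e₂
          simpa [hy.symm] using hθ₂
        · simpa [e₁, e₂] using hv0 y
  have hw : ∑ l, w l = 1 := by
    simp only [w, Fintype.sum_option, Option.elim, Finset.sum_sub_distrib, hv]
    simp
    ring
  have hg : ∑ l, w l * g l = 0 := by
    simp only [w, g, Fintype.sum_option, Option.elim, sub_mul, Finset.sum_sub_distrib, hs, ite_mul,
      zero_mul]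
    simp
    ring
  have hh : ∑ l, w l * h l = 0 := by
    have : ∑ y, w (some y) = 1 - 2 * θ := by
      rw [Fintype.sum_option] at hw
      simp only [w, Option.elim] at hw ⊢
      linarith
    rw [Fintype.sum_option]
    simp only [h, Option.elim, ← Finset.sum_mul, this]
    simp only [w, Option.elim]
    ring
  have hpush : ∀ y, v y = ∑ a with z a = y, w a.1 / 2 := by
    intro y
    rw [Finset.sum_filter, Fintype.sum_prod_type, Fintype.sum_option]
    simp only [Fintype.sum_bool]
    change v y = ((if y₂ = y then 2 * θ / 2 else 0) + (if y₁ = y then 2 * θ / 2 else 0)) +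
      ∑ x, ((if x = y then w (some x) / 2 else 0) + (if x = y then w (some x) / 2 else 0))
    simp only [Finset.sum_add_distrib, Finset.sum_ite_eq', Finset.mem_univ, if_true]
    simp only [w, Option.elim, eq_comm (a := y)]
    split_ifs <;> ring
  obtain ⟨c, hc⟩ : ∃ c, c = 2 * (∑ l, w l * g l ^ 2 + 1) := ⟨_, rfl⟩
  have hσ : 0 ≤ ∑ l, w l * g l ^ 2 := Finset.sum_nonneg fun l _ => mul_nonneg (hw0 l) (sq_nonneg _)
  have hτ : 0 ≤ ∑ l, w l * h l ^ 2 := Finset.sum_nonneg fun l _ => mul_nonneg (hw0 l) (sq_nonneg _)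
  obtain ⟨D, hD⟩ : ∃ D, D = (1 + c) / δ + 1 := ⟨_, rfl⟩
  have hc0 : 0 < c := by rw [hc]; positivity
  have hD1 : 1 ≤ D := by
    have : 0 ≤ (1 + c) / δ := by positivity
    linarith
  obtain ⟨k, hk⟩ : ∃ k, k = Real.exp (-(16 * (D / √θ + 1) ^ 2)) / 4 := ⟨_, rfl⟩
  have hk0 : 0 < k := by rw [hk]; positivity
  refine ⟨k / 2, by positivity, ⌈(64 * (D / √θ + 1) ^ 2 + 2) / θ⌉₊ +
    ⌈4 * (∑ l, w l * h l ^ 2) / θ ^ 2⌉₊ + 1, ?_⟩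
  intro N hN t ht
  have hN1 : (64 * (D / √θ + 1) ^ 2 + 2) ≤ θ * N := by
    have : (64 * (D / √θ + 1) ^ 2 + 2) / θ ≤ N :=
      (Nat.le_ceil _).trans (by exact_mod_cast (by omega))
    rwa [div_le_iff₀' hθ] at this
  have hN2 : 4 * (∑ l, w l * h l ^ 2) ≤ θ ^ 2 * N := by
    have : 4 * (∑ l, w l * h l ^ 2) / θ ^ 2 ≤ N :=
      (Nat.le_ceil _).trans (by exact_mod_cast (by omega))
    rwa [div_le_iff₀' (by positivity)] at this
  have hN0 : (0 : ℝ) < N := by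
    have : 0 < N := by omega
    exact_mod_cast this
  have hsN : 0 < √(N : ℝ) := Real.sqrt_pos.2 hN0
  have hsN2 : √(N : ℝ) ^ 2 = N := Real.sq_sqrt hN0.le
  let P : ℝ → Prop := fun x => t - δ ≤ x ∧ x ≤ t
  let A : (Fin N → Option Y) → Finset (Fin N) := fun l => {n | l n = none}
  have hsum : ∀ (l : Fin N → Option Y) (ε : Fin N → Bool), ∑ n, s (z (l n, ε n)) =
      (∑ n, g (l n) - δ * #(A l) / 2) + δ * #{i ∈ A l | ε i = true} := by
    intro l ε
    have : ∀ n, s (z (l n, ε n)) = g (l n) - δ / 2 * (if l n = none then 1 else 0) +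
        δ * (if l n = none ∧ ε n = true then 1 else 0) := by
      intro n
      rcases l n with _ | y <;> rcases ε n with _ | _ <;> simp [z, g, hδdef] <;> ring
    simp only [this, Finset.sum_add_distrib, Finset.sum_sub_distrib, ← Finset.mul_sum,
      Finset.sum_boole, A, Finset.filter_filter]
    ring
  have hcardA : ∀ l : Fin N → Option Y, ∑ n, h (l n) = #(A l) - 2 * θ * N := by
    intro l
    have : ∀ n, h (l n) = (if l n = none then 1 else 0) - 2 * θ := by
      intro n
      rcases l n with _ | y <;> simp [h]
    simp only [this, Finset.sum_sub_distrib, Finset.sum_boole, A]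
    simp
    ring
  have hprod0 : ∀ l : Fin N → Option Y, 0 ≤ ∏ n, w (l n) :=
    fun l => Finset.prod_nonneg fun n _ => hw0 _
  -- conditionally on the positions of the coins, the window has the required probability
  have hcond : ∀ l : Fin N → Option Y,
      (∏ n, w (l n)) * (k / √N * (1 - ((∑ n, g (l n)) ^ 2 / (c ^ 2 * N) +
        (∑ n, h (l n)) ^ 2 / (θ * N) ^ 2))) ≤
      ∑ ε : Fin N → Bool, (∏ n, w (l n) / 2) * (if P (∑ n, s (z (l n, ε n))) then 1 else 0) := by
    intro l
    have e : ∑ ε : Fin N → Bool, (∏ n, w (l n) / 2) *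
        (if P (∑ n, s (z (l n, ε n))) then (1 : ℝ) else 0) =
        (∏ n, w (l n)) * (#{ε : Fin N → Bool | P (∑ n, s (z (l n, ε n)))} / 2 ^ N) := by
      rw [← Finset.mul_sum, Finset.sum_boole, Finset.prod_div_distrib]
      simp
      ring
    rw [e]
    refine mul_le_mul_of_nonneg_left ?_ (hprod0 l)
    have hq1 : 0 ≤ (∑ n, g (l n)) ^ 2 / (c ^ 2 * N) := by positivity
    have hq2 : 0 ≤ (∑ n, h (l n)) ^ 2 / (θ * N) ^ 2 := by positivity
    have hkN : 0 < k / √(N : ℝ) := by positivity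
    by_cases hU : |∑ n, g (l n)| ≤ c * √N
    swap
    · have : 1 ≤ (∑ n, g (l n)) ^ 2 / (c ^ 2 * N) := by
        rw [le_div_iff₀ (by positivity), ← hsN2, one_mul, ← mul_pow]
        rw [← sq_abs (∑ n, g (l n))]
        exact pow_le_pow_left₀ (by positivity) (not_le.1 hU).le 2
      refine (mul_nonpos_of_nonneg_of_nonpos hkN.le (by linarith)).trans
        (div_nonneg (Nat.cast_nonneg _) (by positivity))
    by_cases hAc : θ * N ≤ #(A l)
    swap
    · have : 1 ≤ (∑ n, h (l n)) ^ 2 / (θ * N) ^ 2 := by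
        rw [le_div_iff₀ (by positivity), one_mul, hcardA]
        have hle : θ * N ≤ 2 * θ * N - #(A l) := by linarith
        calc (θ * N) ^ 2 ≤ (2 * θ * N - #(A l)) ^ 2 :=
              pow_le_pow_left₀ (by positivity) hle 2
          _ = (#(A l) - 2 * θ * N) ^ 2 := by ring
      refine (mul_nonpos_of_nonneg_of_nonpos hkN.le (by linarith)).trans
        (div_nonneg (Nat.cast_nonneg _) (by positivity))
    have hwin := coin_window_lower_bound (A l) (U := ∑ n, g (l n) - δ * #(A l) / 2) (t := t)
      hδ hθ hD1 ?_ hAc hN1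
    · rw [← hk] at hwin
      simp only [← hsum] at hwin
      rw [le_div_iff₀ (by positivity)]
      refine le_trans ?_ hwin
      gcongr
      exact mul_le_of_le_one_right hkN.le (by linarith)
    · have e : δ * (D - 1) * √(N : ℝ) = √N + c * √N := by
        rw [hD]
        field_simp
        ring
      rw [e, sub_add_cancel]
      exact (abs_sub _ _).trans (add_le_add ht hU)
  have htotal : k / 2 / √N ≤ ∑ l : Fin N → Option Y,
      (∏ n, w (l n)) * (k / √N * (1 - ((∑ n, g (l n)) ^ 2 / (c ^ 2 * N) +
        (∑ n, h (l n)) ^ 2 / (θ * N) ^ 2))) := by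
    rw [sum_prod_weights_mul_one_sub w g h hw hg hh]
    have b1 : N * (∑ l, w l * g l ^ 2) / (c ^ 2 * N) ≤ 1 / 4 := by
      rw [div_le_iff₀ (by positivity), hc]
      nlinarith [mul_nonneg hN0.le hσ, mul_nonneg hN0.le (sq_nonneg (∑ l, w l * g l ^ 2))]
    have b2 : N * (∑ l, w l * h l ^ 2) / (θ * N) ^ 2 ≤ 1 / 4 := by
      rw [div_le_iff₀ (by positivity)]
      nlinarith
    have e : k / 2 / √(N : ℝ) = k / √N * (1 / 2) := by ring
    rw [e]
    exact mul_le_mul_of_nonneg_left (by linarith) (by positivity)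
  refine htotal.trans ((Finset.sum_le_sum fun l _ => hcond l).trans (le_of_eq ?_))
  rw [Finset.sum_filter]
  have := sum_prod_pushforward (fun a : Option Y × Bool => w a.1 / 2) z v hpush N
    (fun y => if P (∑ n, s (y n)) then 1 else 0)
  simp only [mul_ite, mul_one, mul_zero] at this ⊢
  rw [this, ← (Equiv.arrowProdEquivProdArrow (Fin N) (fun _ => Option Y) (fun _ => Bool)).symm.sum_comp,
    Fintype.sum_prod_type]
  rfl

end LocalLimit

section Converse

theorem le_average_of_sum_le_one {Ω : Type*} [Fintype Ω] [DecidableEq Ω] {M : ℕ} (hM : 0 < M)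
    {x q w : Ω → ℝ} (hq : ∀ y, 0 ≤ q y) (hw : ∀ y, 0 ≤ w y) (hxq : ∀ y, x y ≤ M * q y)
    {G : Finset Ω} {C : ℝ} (hC : 0 ≤ C) (hxw : ∀ y ∈ G, C * x y ≤ w y)
    (D : Fin M → Finset Ω) (hD : ∑ m, ∑ y ∈ D m, q y ≤ 1) :
    C * (∑ y ∈ G, x y - 1) ≤ (M : ℝ)⁻¹ * ∑ m, ∑ y ∈ (D m)ᶜ, w y := by
  have hM' : (0 : ℝ) < M := by exact_mod_cast hM
  have h1 : ∀ m, C * (∑ y ∈ G, x y - M * ∑ y ∈ D m, q y) ≤ ∑ y ∈ (D m)ᶜ, w y := by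
    intro m
    have e : ∑ y ∈ G, x y = ∑ y ∈ G ∩ D m, x y + ∑ y ∈ G \ D m, x y :=
      (Finset.sum_inter_add_sum_sdiff G (D m) x).symm
    have b1 : ∑ y ∈ G ∩ D m, x y ≤ M * ∑ y ∈ D m, q y := by
      rw [Finset.mul_sum]
      refine (Finset.sum_le_sum fun y _ => hxq y).trans ?_
      exact Finset.sum_le_sum_of_subset_of_nonneg Finset.inter_subset_right
        fun y _ _ => mul_nonneg hM'.le (hq y)
    have b2 : C * ∑ y ∈ G \ D m, x y ≤ ∑ y ∈ (D m)ᶜ, w y := by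
      rw [Finset.mul_sum]
      refine (Finset.sum_le_sum fun y hy => hxw y (Finset.mem_sdiff.1 hy).1).trans ?_
      refine Finset.sum_le_sum_of_subset_of_nonneg ?_ fun y _ _ => hw y
      intro y hy
      simpa using (Finset.mem_sdiff.1 hy).2
    refine le_trans (mul_le_mul_of_nonneg_left ?_ hC) b2
    linarith
  have h2 : C * (M * ∑ y ∈ G, x y - M) ≤ ∑ m, ∑ y ∈ (D m)ᶜ, w y := by
    refine le_trans ?_ (Finset.sum_le_sum fun m _ => h1 m)
    rw [← Finset.mul_sum, Finset.sum_sub_distrib, ← Finset.mul_sum]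
    simp only [Finset.sum_const, Finset.card_univ, Fintype.card_fin, nsmul_eq_mul]
    refine mul_le_mul_of_nonneg_left ?_ hC
    have := mul_le_mul_of_nonneg_left hD hM'.le
    linarith
  rw [inv_mul_eq_div, le_div_iff₀ hM']
  linarith

variable {Y : Type*} [Fintype Y]

theorem one_lt_sum_mul_exp_neg {v s : Y → ℝ} (hv0 : ∀ y, 0 ≤ v y) (hv : ∑ y, v y = 1)
    (hs : ∑ y, v y * s y = 0) (hne : ∃ y, 0 < v y ∧ s y ≠ 0) :
    1 < ∑ y, v y * Real.exp (-s y) := by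
  have h1 : ∑ y, v y * (1 - s y) = 1 := by
    simp only [mul_sub, Finset.sum_sub_distrib, mul_one, hv, hs, sub_zero]
  rw [← h1]
  obtain ⟨y₀, hy₀, hsy₀⟩ := hne
  refine Finset.sum_lt_sum (fun y _ => mul_le_mul_of_nonneg_left ?_ (hv0 y)) ⟨y₀, mem_univ _, ?_⟩
  · have := Real.add_one_le_exp (-s y)
    linarith
  · have := Real.add_one_lt_exp (neg_ne_zero.2 hsy₀)
    exact mul_lt_mul_of_pos_left (by linarith) hy₀

/-- The sphere-packing converse for product measures. The measures `q` and `w` are exponential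
tilts of the law `v` by the centred statistic `s`, and the sets `D m` play the role of
decoding regions. -/
theorem sphere_packing_product_lower_bound [DecidableEq Y] {v s w q : Y → ℝ} (hv0 : ∀ y, 0 ≤ v y)
    (hv : ∑ y, v y = 1) (hs : ∑ y, v y * s y = 0) (hne : ∃ y, 0 < v y ∧ s y ≠ 0)
    {ρ R E : ℝ} (hρ : 0 ≤ ρ) (hq0 : ∀ y, 0 ≤ q y) (hq : ∀ y, v y * Real.exp (-(R + s y)) ≤ q y)
    (hw0 : ∀ y, 0 ≤ w y) (hw : ∀ y, v y * Real.exp (-E + ρ * s y) ≤ w y) :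
    ∃ K : ℝ, 0 < K ∧ ∀ N : ℕ, 0 < N → ∀ M : ℕ, Real.exp (N * R) ≤ M →
      ∀ D : Fin M → Finset (Fin N → Y), ∑ m, ∑ y ∈ D m, ∏ n, q (y n) ≤ 1 →
        K * (N : ℝ) ^ (-(1 + ρ) / 2) * Real.exp (-(N : ℝ) * E) ≤
          (M : ℝ)⁻¹ * ∑ m, ∑ y ∈ (D m)ᶜ, ∏ n, w (y n) := by
  -- the common reduction to an estimate on a set `G` of output words
  have main : ∀ (N M : ℕ), Real.exp (N * R) ≤ M → ∀ (D : Fin M → Finset (Fin N → Y)),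
      ∑ m, ∑ y ∈ D m, ∏ n, q (y n) ≤ 1 → ∀ (G : Finset (Fin N → Y)) (r : ℝ),
      (∀ y ∈ G, r ≤ ∑ n, s (y n)) →
      Real.exp ((1 + ρ) * r) * Real.exp (-(N : ℝ) * E) *
        (∑ y ∈ G, (∏ n, v (y n)) * Real.exp (-∑ n, s (y n)) - 1) ≤
          (M : ℝ)⁻¹ * ∑ m, ∑ y ∈ (D m)ᶜ, ∏ n, w (y n) := by
    intro N M hM D hD G r hG
    have hM0 : 0 < M := by
      have : (0 : ℝ) < M := (Real.exp_pos _).trans_le hM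
      exact_mod_cast this
    refine le_average_of_sum_le_one hM0 (q := fun y : Fin N → Y => ∏ n, q (y n))
      (fun y => Finset.prod_nonneg fun n _ => hq0 _)
      (fun y => Finset.prod_nonneg fun n _ => hw0 _) ?_ (by positivity) ?_ D hD
    · intro y
      have h1 : ∏ n, (v (y n) * Real.exp (-(R + s (y n)))) ≤ ∏ n, q (y n) :=
        Finset.prod_le_prod (fun n _ => mul_nonneg (hv0 _) (Real.exp_pos _).le) fun n _ => hq _
      rw [Finset.prod_mul_distrib, ← Real.exp_sum] at h1
      simp only [Finset.sum_neg_distrib, Finset.sum_add_distrib, Finset.sum_const,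
        Finset.card_univ, Fintype.card_fin, nsmul_eq_mul] at h1
      have e : (∏ n, v (y n)) * Real.exp (-∑ n, s (y n)) = Real.exp (N * R) *
          ((∏ n, v (y n)) * Real.exp (-(N * R + ∑ n, s (y n)))) := by
        rw [neg_add, Real.exp_add, Real.exp_neg (N * R)]
        field_simp
      rw [e]
      exact mul_le_mul hM h1 (mul_nonneg (Finset.prod_nonneg fun n _ => hv0 _)
        (Real.exp_pos _).le) (Nat.cast_nonneg _)
    · intro y hy
      have h1 : ∏ n, (v (y n) * Real.exp (-E + ρ * s (y n))) ≤ ∏ n, w (y n) :=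
        Finset.prod_le_prod (fun n _ => mul_nonneg (hv0 _) (Real.exp_pos _).le) fun n _ => hw _
      rw [Finset.prod_mul_distrib, ← Real.exp_sum] at h1
      simp only [Finset.sum_add_distrib, Finset.sum_const,
        Finset.card_univ, Fintype.card_fin, nsmul_eq_mul, ← Finset.mul_sum] at h1
      refine le_trans ?_ h1
      have e : Real.exp ((1 + ρ) * r) * Real.exp (-(N : ℝ) * E) *
          ((∏ n, v (y n)) * Real.exp (-∑ n, s (y n))) =
          (∏ n, v (y n)) * Real.exp ((1 + ρ) * r + -(N : ℝ) * E + -∑ n, s (y n)) := by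
        rw [Real.exp_add, Real.exp_add]
        ring
      rw [e]
      refine mul_le_mul_of_nonneg_left (Real.exp_le_exp.2 ?_)
        (Finset.prod_nonneg fun n _ => hv0 _)
      nlinarith [hG y hy]
  obtain ⟨y₂, -, hy₂⟩ : ∃ y ∈ univ, 0 < v y * s y := by
    obtain ⟨y, hy, hsy⟩ := hne
    exact Finset.exists_pos_of_sum_zero_of_exists_nonzero _ hs
      ⟨y, mem_univ _, mul_ne_zero hy.ne' hsy⟩
  obtain ⟨y₁, -, hy₁⟩ : ∃ y ∈ univ, 0 < -(v y * s y) := by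
    obtain ⟨y, hy, hsy⟩ := hne
    exact Finset.exists_pos_of_sum_zero_of_exists_nonzero _
      (by simpa using hs) ⟨y, mem_univ _, neg_ne_zero.2 (mul_ne_zero hy.ne' hsy)⟩
  have hv₁ : 0 < v y₁ := (hv0 y₁).lt_of_ne fun h => by simp [← h] at hy₁
  have hv₂ : 0 < v y₂ := (hv0 y₂).lt_of_ne fun h => by simp [← h] at hy₂
  have hs₁ : s y₁ < s y₂ := by
    have a := pos_of_mul_pos_right hy₂ hv₂.le
    have b : s y₁ < 0 := by
      by_contra! h
      have := mul_nonneg hv₁.le h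
      linarith
    linarith
  obtain ⟨k, hk, N₀, hloc⟩ := local_limit_lower_bound v s hv0 hv hs hv₁ hv₂ hs₁
  set δ := s y₂ - s y₁ with hδ
  have hc1 := one_lt_sum_mul_exp_neg hv0 hv hs hne
  set c := ∑ y, v y * Real.exp (-s y) with hc
  set B := ∑ y, |s y| with hB
  have hB0 : 0 ≤ B := Finset.sum_nonneg fun y _ => abs_nonneg _
  set a := Real.log (2 / k) with ha
  set N₁ := N₀ + ⌈4 * a ^ 2⌉₊ with hN₁
  set K₁ := Real.exp ((1 + ρ) * -(N₁ * B)) * (c - 1) with hK₁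
  set K₂ := Real.exp ((1 + ρ) * (-a - δ)) with hK₂
  have hK₁0 : 0 < K₁ := mul_pos (Real.exp_pos _) (by linarith)
  have hK₂0 : 0 < K₂ := Real.exp_pos _
  refine ⟨min K₁ K₂, lt_min hK₁0 hK₂0, ?_⟩
  intro N hN M hM D hD
  have hN0 : (0 : ℝ) < N := by exact_mod_cast hN
  have hN1 : (1 : ℝ) ≤ N := by exact_mod_cast hN
  have hpow0 : 0 ≤ (N : ℝ) ^ (-(1 + ρ) / 2) := by positivity
  rcases le_total N N₁ with hle | hge
  · have h := main N M hM D hD univ (-(N * B)) ?_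
    · refine le_trans ?_ h
      have hsum : ∑ y : Fin N → Y, (∏ n, v (y n)) * Real.exp (-∑ n, s (y n)) = c ^ N := by
        rw [hc, ← sum_prod_weights]
        refine Finset.sum_congr rfl fun y _ => ?_
        rw [Finset.prod_mul_distrib, ← Real.exp_sum, Finset.sum_neg_distrib]
      rw [hsum]
      have hcN : c - 1 ≤ c ^ N - 1 := by
        have := le_self_pow₀ hc1.le hN.ne'
        linarith
      have hpow1 : (N : ℝ) ^ (-(1 + ρ) / 2) ≤ 1 :=
        Real.rpow_le_one_of_one_le_of_nonpos hN1 (by linarith)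
      have hexp : Real.exp ((1 + ρ) * -(N₁ * B)) ≤ Real.exp ((1 + ρ) * -(N * B)) := by
        apply Real.exp_le_exp.2
        have : (N : ℝ) ≤ N₁ := by exact_mod_cast hle
        have := mul_le_mul_of_nonneg_right this hB0
        exact mul_le_mul_of_nonneg_left (by linarith) (by linarith)
      calc min K₁ K₂ * (N : ℝ) ^ (-(1 + ρ) / 2) * Real.exp (-(N : ℝ) * E)
          ≤ K₁ * 1 * Real.exp (-(N : ℝ) * E) := by
            gcongr
            exact min_le_left _ _
        _ = Real.exp ((1 + ρ) * -(N₁ * B)) * Real.exp (-(N : ℝ) * E) * (c - 1) := by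
            rw [hK₁]
            ring
        _ ≤ _ := by
            gcongr
    · intro y _
      have : ∀ n, -B ≤ s (y n) := fun n =>
        (neg_le_neg (Finset.single_le_sum (f := fun y => |s y|) (fun y _ => abs_nonneg _)
          (mem_univ (y n)))).trans (neg_abs_le _)
      have h := Finset.sum_le_sum (s := univ) fun n _ => this n
      simpa using h
  · have hN₀ : N₀ ≤ N := by omega
    have hs2 : √(N : ℝ) ^ 2 = N := Real.sq_sqrt hN0.le
    have hs1 : 1 ≤ √(N : ℝ) := Real.one_le_sqrt.2 hN1
    have hs0 : 0 < √(N : ℝ) := by linarith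
    have hlog0 : 0 ≤ Real.log √(N : ℝ) := Real.log_nonneg hs1
    have hlog1 : Real.log √(N : ℝ) ≤ √(N : ℝ) / 2 := by
      have h := Real.log_le_sub_one_of_pos (show 0 < √(N : ℝ) / 2 by positivity)
      rw [Real.log_div hs0.ne' two_ne_zero] at h
      have := Real.log_two_lt_d9
      linarith
    have haN : |a| ≤ √(N : ℝ) / 2 := by
      have h4 : 4 * a ^ 2 ≤ N := (Nat.le_ceil _).trans (by exact_mod_cast (by omega))
      apply abs_le_of_sq_le_sq _ (by positivity)
      rw [div_pow, hs2]
      linarith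
    set t := -(a + Real.log √(N : ℝ)) with ht
    have htN : |t| ≤ √(N : ℝ) := by
      rw [ht, abs_neg]
      refine (abs_add_le _ _).trans ?_
      rw [abs_of_nonneg hlog0]
      linarith
    have hl := hloc N hN₀ t htN
    have hexpt : Real.exp (-t) = 2 / k * √(N : ℝ) := by
      rw [ht, neg_neg, Real.exp_add, ha, Real.exp_log (by positivity), Real.exp_log hs0]
    have h := main N M hM D hD {y | t - δ ≤ ∑ n, s (y n) ∧ ∑ n, s (y n) ≤ t} (t - δ) fun y hy => (Finset.mem_filter.1 hy).2.1
    refine le_trans ?_ h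
    have hsum : 2 ≤ ∑ y : Fin N → Y with t - δ ≤ ∑ n, s (y n) ∧ ∑ n, s (y n) ≤ t,
        (∏ n, v (y n)) * Real.exp (-∑ n, s (y n)) := by
      calc (2 : ℝ) = (k / √(N : ℝ)) * Real.exp (-t) := by
            rw [hexpt]
            field_simp
        _ ≤ (∑ y : Fin N → Y with t - δ ≤ ∑ n, s (y n) ∧ ∑ n, s (y n) ≤ t,
              ∏ n, v (y n)) * Real.exp (-t) := by gcongr
        _ ≤ _ := by
            rw [Finset.sum_mul]
            refine Finset.sum_le_sum fun y hy => mul_le_mul_of_nonneg_left ?_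
              (Finset.prod_nonneg fun n _ => hv0 _)
            exact Real.exp_le_exp.2 (neg_le_neg (Finset.mem_filter.1 hy).2.2)
    have hK : Real.exp ((1 + ρ) * (t - δ)) = K₂ * (N : ℝ) ^ (-(1 + ρ) / 2) := by
      rw [hK₂, Real.rpow_def_of_pos hN0, ← Real.exp_add, ht, Real.log_sqrt hN0.le]
      congr 1
      ring
    rw [hK]
    calc min K₁ K₂ * (N : ℝ) ^ (-(1 + ρ) / 2) * Real.exp (-(N : ℝ) * E)
        ≤ K₂ * (N : ℝ) ^ (-(1 + ρ) / 2) * Real.exp (-(N : ℝ) * E) * 1 := by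
          rw [mul_one]
          gcongr
          exact min_le_right _ _
      _ ≤ _ := by
          gcongr
          linarith

end Converse

section GallagerFunction

theorem IsDMC.le_one {X Y : Type} [Fintype Y] {W : X → Y → ℝ} (hW : IsDMC W) (x : X) (y : Y) : W x y ≤ 1 := by
  rw [← hW.2 x]
  exact Finset.single_le_sum (f := W x) (fun y _ => hW.1 x y) (mem_univ y)

theorem inv_card_rpow_le_gallager_sum [Nonempty Y] {W : X → Y → ℝ} (hW : IsDMC W) {Q : X → ℝ}
    (hQ : IsProbDist Q) {ρ : ℝ} (hρ : 0 ≤ ρ) :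
    ((Fintype.card Y : ℝ)⁻¹) ^ (1 + ρ) ≤
      ∑ y, (∑ x, Q x * W x y ^ (1 / (1 + ρ))) ^ (1 + ρ) := by
  have hρ1 : 0 < 1 + ρ := by linarith
  have hα : ∀ y, 0 ≤ ∑ x, Q x * W x y ^ (1 / (1 + ρ)) := fun y =>
    Finset.sum_nonneg fun x _ => mul_nonneg (hQ.1 x) (Real.rpow_nonneg (hW.1 x y) _)
  have hsum : ∑ y, ∑ x, Q x * W x y = 1 := by
    rw [Finset.sum_comm]
    simp only [← Finset.mul_sum, hW.2, mul_one, hQ.2]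
  obtain ⟨y, -, hy⟩ : ∃ y ∈ (univ : Finset Y), (Fintype.card Y : ℝ)⁻¹ ≤ ∑ x, Q x * W x y := by
    refine Finset.exists_le_of_sum_le univ_nonempty (le_of_eq ?_)
    rw [hsum]
    simp
  have hy' : ∑ x, Q x * W x y ≤ ∑ x, Q x * W x y ^ (1 / (1 + ρ)) := by
    refine Finset.sum_le_sum fun x _ => mul_le_mul_of_nonneg_left ?_ (hQ.1 x)
    refine Real.self_le_rpow_of_le_one (hW.1 x y) (hW.le_one x y) ?_
    rw [div_le_one hρ1]
    linarith
  calc ((Fintype.card Y : ℝ)⁻¹) ^ (1 + ρ)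
      ≤ (∑ x, Q x * W x y ^ (1 / (1 + ρ))) ^ (1 + ρ) :=
        Real.rpow_le_rpow (by positivity) (hy.trans hy') hρ1.le
    _ ≤ _ := Finset.single_le_sum
        (f := fun y => (∑ x, Q x * W x y ^ (1 / (1 + ρ))) ^ (1 + ρ))
        (fun y _ => Real.rpow_nonneg (hα y) _) (mem_univ y)

theorem gallager_sum_pos [Nonempty Y] {W : X → Y → ℝ} (hW : IsDMC W) {Q : X → ℝ}
    (hQ : IsProbDist Q) {ρ : ℝ} (hρ : 0 ≤ ρ) :
    0 < ∑ y, (∑ x, Q x * W x y ^ (1 / (1 + ρ))) ^ (1 + ρ) :=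
  lt_of_lt_of_le (by positivity) (inv_card_rpow_le_gallager_sum hW hQ hρ)

theorem Eo_le_mul_log_card [Nonempty Y] {W : X → Y → ℝ} (hW : IsDMC W) {Q : X → ℝ}
    (hQ : IsProbDist Q) {ρ : ℝ} (hρ : 0 ≤ ρ) :
    Eo W Q ρ ≤ (1 + ρ) * Real.log (Fintype.card Y) := by
  have h := Real.log_le_log (by positivity) (inv_card_rpow_le_gallager_sum hW hQ hρ)
  rw [Real.log_rpow (by positivity), Real.log_inv] at h
  rw [Eo]
  linarith

theorem bddAbove_ESPset_of_Rinf_lt [Nonempty Y] {W : X → Y → ℝ} (hW : IsDMC W) {R : ℝ}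
    (hR : Rinf W < R) : BddAbove (ESPset W R) := by
  by_contra hcon
  refine notMem_of_csSup_lt hR ?_ hcon
  refine ⟨Real.log (Fintype.card Y), fun r hr => ?_⟩
  by_contra! hlt
  refine hr ⟨Real.log (Fintype.card Y), ?_⟩
  rintro e ⟨Q, hQ, ρ, hρ, rfl⟩
  have := Eo_le_mul_log_card hW hQ hρ
  nlinarith

theorem hasDerivAt_const_rpow_one_div {a ρ : ℝ} (ha : 0 ≤ a) (hρ : 0 ≤ ρ) :
    HasDerivAt (fun r : ℝ => a ^ (1 / (1 + r)))
      (-(1 / (1 + ρ) ^ 2) * (a ^ (1 / (1 + ρ)) * Real.log a)) ρ := by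
  have hρ1 : 1 + ρ ≠ 0 := by positivity
  rcases ha.eq_or_lt with rfl | ha
  · have h : (fun r : ℝ => (0 : ℝ) ^ (1 / (1 + r))) =ᶠ[nhds ρ] fun _ => 0 := by
      filter_upwards [lt_mem_nhds (show -1 < ρ by linarith)] with r hr
      refine Real.zero_rpow (one_div_ne_zero ?_)
      linarith
    simpa using (hasDerivAt_const ρ (0 : ℝ)).congr_of_eventuallyEq h
  · have h1 : HasDerivAt (fun r : ℝ => 1 / (1 + r)) (-(1 / (1 + ρ) ^ 2)) ρ := by
      simpa [neg_div, one_div] using ((hasDerivAt_id ρ).const_add 1).fun_inv hρ1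
    convert h1.const_rpow ha using 1
    ring

theorem hasDerivAt_Eo [Nonempty Y] {W : X → Y → ℝ} (hW : IsDMC W) {Q : X → ℝ}
    (hQ : IsProbDist Q) {ρ : ℝ} (hρ : 0 ≤ ρ) :
    HasDerivAt (Eo W Q)
      (-(∑ y, ((∑ x, Q x * W x y ^ (1 / (1 + ρ))) ^ (1 + ρ) *
            Real.log (∑ x, Q x * W x y ^ (1 / (1 + ρ))) -
          (∑ x, Q x * W x y ^ (1 / (1 + ρ))) ^ ρ *
            (∑ x, Q x * (W x y ^ (1 / (1 + ρ)) * Real.log (W x y))) / (1 + ρ))) /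
        ∑ y, (∑ x, Q x * W x y ^ (1 / (1 + ρ))) ^ (1 + ρ)) ρ := by
  have hρ1 : 0 < 1 + ρ := by linarith
  have hF := gallager_sum_pos hW hQ hρ
  have hterm : ∀ y, HasDerivAt (fun r : ℝ => (∑ x, Q x * W x y ^ (1 / (1 + r))) ^ (1 + r))
      ((∑ x, Q x * W x y ^ (1 / (1 + ρ))) ^ (1 + ρ) *
            Real.log (∑ x, Q x * W x y ^ (1 / (1 + ρ))) -
          (∑ x, Q x * W x y ^ (1 / (1 + ρ))) ^ ρ *
            (∑ x, Q x * (W x y ^ (1 / (1 + ρ)) * Real.log (W x y))) / (1 + ρ)) ρ := by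
    intro y
    have hα : 0 ≤ ∑ x, Q x * W x y ^ (1 / (1 + ρ)) :=
      Finset.sum_nonneg fun x _ => mul_nonneg (hQ.1 x) (Real.rpow_nonneg (hW.1 x y) _)
    rcases hα.eq_or_lt with h0 | hpos
    · have hx : ∀ x, Q x = 0 ∨ W x y = 0 := by
        intro x
        have := (Finset.sum_eq_zero_iff_of_nonneg fun x _ =>
          mul_nonneg (hQ.1 x) (Real.rpow_nonneg (hW.1 x y) _)).1 h0.symm x (mem_univ x)
        rcases mul_eq_zero.1 this with h | h
        · exact Or.inl h
        · exact Or.inr ((Real.rpow_eq_zero (hW.1 x y) (by positivity)).1 h)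
      have hz : ∀ r : ℝ, -1 < r → ∑ x, Q x * W x y ^ (1 / (1 + r)) = 0 := by
        intro r hr
        refine Finset.sum_eq_zero fun x _ => ?_
        rcases hx x with h | h
        · simp [h]
        · rw [h, Real.zero_rpow (one_div_ne_zero (by linarith)), mul_zero]
      have hz' : ∑ x, Q x * (W x y ^ (1 / (1 + ρ)) * Real.log (W x y)) = 0 := by
        refine Finset.sum_eq_zero fun x _ => ?_
        rcases hx x with h | h <;> simp [h]
      have h : (fun r : ℝ => (∑ x, Q x * W x y ^ (1 / (1 + r))) ^ (1 + r)) =ᶠ[nhds ρ]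
          fun _ => 0 := by
        filter_upwards [lt_mem_nhds (show -1 < ρ by linarith)] with r hr
        rw [hz r hr, Real.zero_rpow (by linarith)]
      rw [hz', ← h0]
      simpa using (hasDerivAt_const ρ (0 : ℝ)).congr_of_eventuallyEq h
    · have h1 : HasDerivAt (fun r : ℝ => ∑ x, Q x * W x y ^ (1 / (1 + r)))
          (∑ x, Q x * (-(1 / (1 + ρ) ^ 2) * (W x y ^ (1 / (1 + ρ)) * Real.log (W x y)))) ρ :=
        HasDerivAt.fun_sum fun x _ =>
          (hasDerivAt_const_rpow_one_div (hW.1 x y) hρ).const_mul (Q x)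
      have h2 : HasDerivAt (fun r : ℝ => 1 + r) 1 ρ := (hasDerivAt_id ρ).const_add 1
      convert h1.rpow h2 hpos using 1
      have e : ∑ x, Q x * (-(1 / (1 + ρ) ^ 2) * (W x y ^ (1 / (1 + ρ)) * Real.log (W x y))) =
          -(1 / (1 + ρ) ^ 2) * ∑ x, Q x * (W x y ^ (1 / (1 + ρ)) * Real.log (W x y)) := by
        rw [Finset.mul_sum]
        exact Finset.sum_congr rfl fun x _ => by ring
      rw [e, add_sub_cancel_left]
      field_simp
      ring
  have hsum := HasDerivAt.fun_sum (u := univ) fun y _ => hterm y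
  exact (hsum.log hF.ne').neg.congr_deriv (by rw [neg_div])

theorem hasDerivAt_Eo_zero [Nonempty Y] {W : X → Y → ℝ} (hW : IsDMC W) {Q : X → ℝ}
    (hQ : IsProbDist Q) : HasDerivAt (Eo W Q) (mutualInfo W Q) 0 := by
  convert hasDerivAt_Eo hW hQ le_rfl using 1
  simp only [add_zero, div_one, Real.rpow_one, Real.rpow_zero, one_mul]
  have hsum : ∑ y, ∑ x, Q x * W x y = 1 := by
    rw [Finset.sum_comm]
    simp only [← Finset.mul_sum, hW.2, mul_one, hQ.2]
  rw [hsum, div_one, mutualInfo, Finset.sum_comm, ← Finset.sum_neg_distrib]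
  refine Finset.sum_congr rfl fun y _ => ?_
  rw [Finset.sum_mul, ← Finset.sum_sub_distrib, ← Finset.sum_neg_distrib]
  refine Finset.sum_congr rfl fun x _ => ?_
  rcases eq_or_ne (Q x * W x y) 0 with h | h
  · rw [← mul_assoc, h]
    simp
  · have hpos : 0 < ∑ z, Q z * W z y :=
      lt_of_lt_of_le ((mul_nonneg (hQ.1 x) (hW.1 x y)).lt_of_ne' h)
        (Finset.single_le_sum (f := fun z => Q z * W z y)
          (fun z _ => mul_nonneg (hQ.1 z) (hW.1 z y)) (mem_univ x))
    rw [Real.log_div (right_ne_zero_of_mul h) hpos.ne']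
    ring

theorem Eo_zero {W : X → Y → ℝ} (hW : IsDMC W) {Q : X → ℝ} (hQ : IsProbDist Q) :
    Eo W Q 0 = 0 := by
  have hsum : ∑ y, ∑ x, Q x * W x y = 1 := by
    rw [Finset.sum_comm]
    simp only [← Finset.mul_sum, hW.2, mul_one, hQ.2]
  simp [Eo, hsum]

/-- The tangent line inequality for the convex function `t ↦ t ^ (1 + ρ)`. -/
theorem rpow_tangent_le {a b ρ : ℝ} (ha : 0 ≤ a) (hb : 0 ≤ b) (hρ : 0 ≤ ρ) :
    a ^ (1 + ρ) + (1 + ρ) * (a ^ ρ * (b - a)) ≤ b ^ (1 + ρ) := by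
  rcases ha.eq_or_lt with rfl | ha
  · rcases hρ.eq_or_lt with rfl | hρ
    · simp
    · rw [Real.zero_rpow (by linarith), Real.zero_rpow hρ.ne']
      simpa using Real.rpow_nonneg hb _
  · have h := one_add_mul_self_le_rpow_one_add (s := b / a - 1) (p := 1 + ρ)
      (by have := div_nonneg hb ha.le; linarith) (by linarith)
    rw [add_sub_cancel, Real.div_rpow hb ha.le, le_div_iff₀ (by positivity)] at h
    have e : a ^ (1 + ρ) = a * a ^ ρ := by rw [Real.rpow_add ha, Real.rpow_one]
    refine le_trans (le_of_eq ?_) h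
    rw [e]
    field_simp

end GallagerFunction

section Symmetry

/-- In a Gallager symmetric channel every row is obtained from a given one by a permutation of
the outputs that preserves the columns up to permutation. -/
theorem GallagerSymmetric.exists_perm {W : X → Y → ℝ} (hsym : GallagerSymmetric W) (x₀ : X) :
    ∃ σ : X → Equiv.Perm Y, (∀ x y, W x (σ x y) = W x₀ y) ∧
      ∀ x y (g : ℝ → ℝ), ∑ z, g (W z (σ x y)) = ∑ z, g (W z y) := by
  classical
  obtain ⟨cls, hrow, hcol⟩ := hsym
  have hcard : ∀ x (c : ℕ × ℝ), Nonempty ({y // (cls y, W x₀ y) = c} ≃ {y // (cls y, W x y) = c}) := by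
    rintro x ⟨l, a⟩
    refine ⟨Fintype.equivOfCardEq ?_⟩
    have h := congrArg (Multiset.count a) (hrow l x₀ x)
    rw [Multiset.count_map, Multiset.count_map, ← Finset.filter_val, ← Finset.filter_val,
      Finset.card_val, Finset.card_val, Finset.filter_filter, Finset.filter_filter] at h
    rw [Fintype.card_subtype, Fintype.card_subtype]
    simpa only [Prod.mk.injEq, eq_comm (a := a)] using h
  let e := fun x c => (hcard x c).some
  let σ : X → Equiv.Perm Y := fun x => Equiv.ofFiberEquiv (e x)
  have hσ : ∀ x y, (cls (σ x y), W x (σ x y)) = (cls y, W x₀ y) :=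
    fun x y => Equiv.ofFiberEquiv_map (e x) y
  refine ⟨σ, fun x y => (Prod.ext_iff.1 (hσ x y)).2, fun x y g => ?_⟩
  have h := hcol (σ x y) y (Prod.ext_iff.1 (hσ x y)).1
  have h' := congrArg (fun m => (Multiset.map g m).sum) h
  simp only [Multiset.map_map, Function.comp_def] at h'
  exact h'

end Symmetry

section UniformInput

/-- The uniform distribution on the input alphabet. -/
noncomputable def uniformInput (X : Type) [Fintype X] : X → ℝ := fun _ => (Fintype.card X : ℝ)⁻¹

theorem isProbDist_uniformInput [Nonempty X] : IsProbDist (uniformInput X) :=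
  ⟨fun _ => by unfold uniformInput; positivity, by simp [uniformInput]⟩

/-- The power mean of the columns of `W` under the uniform input distribution. -/
noncomputable def columnMean (W : X → Y → ℝ) (ρ : ℝ) (y : Y) : ℝ :=
  ∑ x, uniformInput X x * W x y ^ (1 / (1 + ρ))

theorem columnMean_nonneg {W : X → Y → ℝ} (hW : IsDMC W) (ρ : ℝ) (y : Y) :
    0 ≤ columnMean W ρ y :=
  Finset.sum_nonneg fun x _ => mul_nonneg (by unfold uniformInput; positivity)
    (Real.rpow_nonneg (hW.1 x y) _)

theorem columnMean_pos {W : X → Y → ℝ} (hW : IsDMC W) (ρ : ℝ) {x : X} {y : Y} (h : 0 < W x y) :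
    0 < columnMean W ρ y := by
  have : Nonempty X := ⟨x⟩
  refine Finset.sum_pos' (fun x _ => mul_nonneg (by unfold uniformInput; positivity)
    (Real.rpow_nonneg (hW.1 x y) _)) ⟨x, mem_univ x, ?_⟩
  unfold uniformInput
  positivity

theorem columnMean_perm {X Y : Type} [Fintype X] {W : X → Y → ℝ} {σ : X → Equiv.Perm Y}
    (hσ : ∀ x y (g : ℝ → ℝ), ∑ z, g (W z (σ x y)) = ∑ z, g (W z y)) (ρ : ℝ) (x : X) (y : Y) :
    columnMean W ρ (σ x y) = columnMean W ρ y :=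
  hσ x y fun t => (Fintype.card X : ℝ)⁻¹ * t ^ (1 / (1 + ρ))

/-- Averaging a function of the rows of a symmetric channel against a symmetric weight does not
depend on the input distribution. -/
theorem sum_row_mul_eq {W : X → Y → ℝ} {x₀ : X} {σ : X → Equiv.Perm Y}
    (hσ : ∀ x y, W x (σ x y) = W x₀ y) {Q : X → ℝ} (hQ : IsProbDist Q) (g : ℝ → ℝ) (h : Y → ℝ)
    (hh : ∀ x y, h (σ x y) = h y) :
    ∑ y, h y * ∑ x, Q x * g (W x y) = ∑ y, h y * g (W x₀ y) := by
  have hx : ∀ x, ∑ y, h y * g (W x y) = ∑ y, h y * g (W x₀ y) := by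
    intro x
    rw [← Equiv.sum_comp (σ x) fun y => h y * g (W x y)]
    simp only [hh, hσ]
  simp only [Finset.mul_sum]
  rw [Finset.sum_comm]
  calc ∑ x, ∑ y, h y * (Q x * g (W x y)) = ∑ x, Q x * ∑ y, h y * g (W x y) := by
        refine Finset.sum_congr rfl fun x _ => ?_
        rw [Finset.mul_sum]
        exact Finset.sum_congr rfl fun y _ => by ring
    _ = ∑ y, h y * g (W x₀ y) := by
        simp only [hx, ← Finset.sum_mul, hQ.2, one_mul]

/-- The uniform input distribution maximizes Gallager's function of a symmetric channel. -/
theorem Eo_le_Eo_uniformInput [Nonempty X] [Nonempty Y] {W : X → Y → ℝ} (hW : IsDMC W)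
    (hsym : GallagerSymmetric W) {Q : X → ℝ} (hQ : IsProbDist Q) {ρ : ℝ} (hρ : 0 ≤ ρ) :
    Eo W Q ρ ≤ Eo W (uniformInput X) ρ := by
  obtain ⟨σ, hσ, hcol⟩ := hsym.exists_perm (Classical.arbitrary X)
  have hU := isProbDist_uniformInput (X := X)
  rw [Eo, Eo, neg_le_neg_iff]
  refine Real.log_le_log (gallager_sum_pos hW hU hρ) ?_
  have hh : ∀ x y, columnMean W ρ (σ x y) ^ ρ = columnMean W ρ y ^ ρ := fun x y => by
    rw [columnMean_perm hcol]
  have e1 := sum_row_mul_eq hσ hQ (fun t => t ^ (1 / (1 + ρ))) (fun y => columnMean W ρ y ^ ρ) hh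
  have e2 := sum_row_mul_eq hσ hU (fun t => t ^ (1 / (1 + ρ))) (fun y => columnMean W ρ y ^ ρ) hh
  have hle : ∀ y, columnMean W ρ y ^ (1 + ρ) + (1 + ρ) * (columnMean W ρ y ^ ρ *
      (∑ x, Q x * W x y ^ (1 / (1 + ρ)) - columnMean W ρ y)) ≤
      (∑ x, Q x * W x y ^ (1 / (1 + ρ))) ^ (1 + ρ) := fun y =>
    rpow_tangent_le (columnMean_nonneg hW ρ y)
      (Finset.sum_nonneg fun x _ => mul_nonneg (hQ.1 x) (Real.rpow_nonneg (hW.1 x y) _)) hρ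
  have hsum := Finset.sum_le_sum fun y (_ : y ∈ univ) => hle y
  simp only [mul_sub, Finset.sum_add_distrib, Finset.sum_sub_distrib, ← Finset.mul_sum] at hsum
  have e3 : ∑ y, columnMean W ρ y ^ ρ * columnMean W ρ y =
      ∑ y, columnMean W ρ y ^ ρ * ∑ x, Q x * W x y ^ (1 / (1 + ρ)) := e2.trans e1.symm
  rw [e3, sub_self, add_zero] at hsum
  exact hsum

/-- The optimal parameter in the sphere-packing exponent is an interior critical point. -/
theorem exists_critical_parameter [Nonempty X] [Nonempty Y] {W : X → Y → ℝ} (hW : IsDMC W)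
    (hsym : GallagerSymmetric W) {R : ℝ} (hR1 : Rinf W < R) (hR2 : R < capacity W) :
    ∃ ρ : ℝ, 0 < ρ ∧ HasDerivAt (Eo W (uniformInput X)) R ρ ∧
      ESP W R = Eo W (uniformInput X) ρ - ρ * R := by
  have hU := isProbDist_uniformInput (X := X)
  set G := Eo W (uniformInput X) with hG
  have hcont : ContinuousOn (fun r => G r - r * R) (Set.Ici 0) := fun r hr =>
    ((hasDerivAt_Eo hW hU hr).continuousAt.sub
      (continuousAt_id.mul continuousAt_const)).continuousWithinAt
  obtain ⟨R', hR', hR'R⟩ := exists_between hR1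
  obtain ⟨B, hB⟩ := bddAbove_ESPset_of_Rinf_lt hW hR'
  have hGB : ∀ r, 0 ≤ r → G r - r * R' ≤ B := fun r hr => hB ⟨_, hU, r, hr, rfl⟩
  have hG0 : G 0 = 0 := Eo_zero hW hU
  have hB0 : 0 ≤ B := by simpa [hG0] using hGB 0 le_rfl
  obtain ⟨ρ, ⟨hρ0, hρT⟩, hmaxT⟩ := isCompact_Icc.exists_isMaxOn
    (s := Set.Icc (0 : ℝ) (B / (R - R'))) (f := fun r => G r - r * R)
    (Set.nonempty_Icc.2 (div_nonneg hB0 (by linarith)))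
    (hcont.mono fun r hr => hr.1)
  have hmax : ∀ r, 0 ≤ r → G r - r * R ≤ G ρ - ρ * R := by
    intro r hr
    rcases le_total r (B / (R - R')) with h | h
    · exact hmaxT ⟨hr, h⟩
    · have h0 : G 0 - 0 * R ≤ G ρ - ρ * R := hmaxT ⟨le_rfl, div_nonneg hB0 (by linarith)⟩
      rw [hG0] at h0
      rw [div_le_iff₀ (by linarith)] at h
      have := hGB r hr
      nlinarith
  have hρ : 0 < ρ := by
    rcases hρ0.eq_or_lt with rfl | h
    · exfalso
      have hne : {r | ∃ Q, IsProbDist Q ∧ r = mutualInfo W Q}.Nonempty := ⟨_, _, hU, rfl⟩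
      obtain ⟨_, ⟨Q, hQ, rfl⟩, hI⟩ := exists_lt_of_lt_csSup hne hR2
      have hslope := (hasDerivAt_Eo_zero hW hQ).tendsto_slope_zero_right
      have hle : mutualInfo W Q ≤ R := by
        refine le_of_tendsto hslope ?_
        filter_upwards [self_mem_nhdsWithin] with t ht
        have ht : 0 < t := ht
        have h1 := Eo_le_Eo_uniformInput hW hsym hQ ht.le
        have h2 := hmax t ht.le
        rw [hG0] at h2
        rw [zero_add, Eo_zero hW hQ, sub_zero, smul_eq_mul, inv_mul_le_iff₀ ht]
        linarith
      linarith
    · exact h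
  have hd := hasDerivAt_Eo hW hU hρ.le
  have hloc : IsLocalMax (fun r => G r - r * R) ρ := by
    filter_upwards [lt_mem_nhds hρ] with r hr using hmax r hr.le
  have h0 := hloc.hasDerivAt_eq_zero (hd.sub ((hasDerivAt_id ρ).mul_const R))
  refine ⟨ρ, hρ, hd.congr_deriv (by linarith), ?_⟩
  refine le_antisymm (csSup_le ⟨_, _, hU, ρ, hρ.le, rfl⟩ ?_)
    (le_csSup (bddAbove_ESPset_of_Rinf_lt hW hR1) ⟨_, hU, ρ, hρ.le, rfl⟩)
  rintro e ⟨Q, hQ, r, hr, rfl⟩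
  exact (sub_le_sub_right (Eo_le_Eo_uniformInput hW hsym hQ hr) _).trans (hmax r hr)

/-- The envelope theorem for the sphere-packing exponent. -/
theorem hasDerivAt_ESP_unique [Nonempty Y] {W : X → Y → ℝ} (hW : IsDMC W) {R : ℝ}
    (hR1 : Rinf W < R) {Q : X → ℝ} (hQ : IsProbDist Q) {ρ : ℝ} (hρ : 0 ≤ ρ)
    (hE : ESP W R = Eo W Q ρ - ρ * R) {d : ℝ} (hd : HasDerivAt (ESP W) d R) : d = -ρ := by
  have hloc : IsLocalMin (fun r => ESP W r + r * ρ) R := by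
    filter_upwards [lt_mem_nhds hR1] with r hr
    have : Eo W Q ρ - ρ * r ≤ ESP W r :=
      le_csSup (bddAbove_ESPset_of_Rinf_lt hW hr) ⟨Q, hQ, ρ, hρ, rfl⟩
    rw [hE]
    linarith
  have := hloc.hasDerivAt_eq_zero (hd.add ((hasDerivAt_id R).mul_const ρ))
  linarith

end UniformInput

section Feedback

/-- Permuting each output letter according to a causally chosen input is injective on words. -/
theorem injective_causal_perm {X Y : Type} {N : ℕ} {σ : X → Equiv.Perm Y} {g : (Fin N → Y) → Fin N → X}
    (hg : ∀ y y' n, (∀ k, k < n → y k = y' k) → g y n = g y' n) :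
    Function.Injective fun (y : Fin N → Y) n => (σ (g y n)).symm (y n) := by
  intro y y' h
  funext n
  induction n using WellFoundedLT.induction with
  | ind n ih =>
    have hn := congrFun h n
    simp only [hg y y' n ih] at hn
    exact (σ (g y' n)).symm.injective hn

/-- Rereading every output word as an output of the constant input `x₀` turns a feedback code into
decoding regions with the same error probability. -/
theorem exists_decoding_regions {X Y : Type} [Fintype Y] [DecidableEq Y] {W : X → Y → ℝ} {x₀ : X} {σ : X → Equiv.Perm Y}
    (hσ : ∀ x y, W x (σ x y) = W x₀ y) {q : Y → ℝ} (hq : ∀ x y, q (σ x y) = q y) {N M : ℕ}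
    {f : Fin M → (Fin N → Y) → Fin N → X} (hf : Causal f) (φ : (Fin N → Y) → Fin M) :
    ∃ D : Fin M → Finset (Fin N → Y), ∑ m, ∑ y ∈ D m, ∏ n, q (y n) = (∑ y, q y) ^ N ∧
      (M : ℝ)⁻¹ * ∑ m, ∑ y ∈ (D m)ᶜ, ∏ n, W x₀ (y n) = avgErrorProbFb W f φ := by
  have hbij : ∀ m, Function.Bijective fun (y : Fin N → Y) n => (σ (f m y n)).symm (y n) :=
    fun m => Finite.injective_iff_bijective.1 (injective_causal_perm (hf m))
  let Φ : Fin M → Equiv.Perm (Fin N → Y) := fun m => Equiv.ofBijective _ (hbij m)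
  have hΦ : ∀ m y n, σ (f m y n) (Φ m y n) = y n := fun m y n =>
    (σ (f m y n)).apply_symm_apply (y n)
  refine ⟨fun m => (univ.filter fun y => φ y = m).map (Φ m).toEmbedding, ?_, ?_⟩
  · simp only [Finset.sum_map, Equiv.coe_toEmbedding]
    have e : ∀ m y, ∏ n, q (Φ m y n) = ∏ n, q (y n) := fun m y =>
      Finset.prod_congr rfl fun n _ => by rw [← hq (f m y n), hΦ]
    simp only [e]
    rw [Finset.sum_fiberwise, sum_prod_weights]
  · rw [avgErrorProbFb]
    congr 1
    refine Finset.sum_congr rfl fun m _ => ?_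
    have hc : ((univ.filter fun y => φ y = m).map (Φ m).toEmbedding)ᶜ =
        (univ.filter fun y => φ y ≠ m).map (Φ m).toEmbedding := by
      ext y
      simp [Finset.mem_map_equiv]
    rw [hc, Finset.sum_map]
    refine Finset.sum_congr rfl fun y _ => Finset.prod_congr rfl fun n _ => ?_
    rw [Equiv.coe_toEmbedding, ← hσ (f m y n), hΦ]

end Feedback

section TiltedChannel

/-- The exponentially tilted row of a symmetric nonsingular channel. -/
theorem exists_tilted_row [Nonempty X] [Nonempty Y] {W : X → Y → ℝ} (hW : IsDMC W)
    (hns : ¬ Singular W) {x₀ : X} {σ : X → Equiv.Perm Y} (hσ : ∀ x y, W x (σ x y) = W x₀ y)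
    (hcol : ∀ x y (g : ℝ → ℝ), ∑ z, g (W z (σ x y)) = ∑ z, g (W z y))
    {ρ R : ℝ} (hρ : 0 ≤ ρ) (hd : HasDerivAt (Eo W (uniformInput X)) R ρ) :
    ∃ v s q : Y → ℝ, (∀ y, 0 ≤ v y) ∧ ∑ y, v y = 1 ∧ ∑ y, v y * s y = 0 ∧
      (∃ y, 0 < v y ∧ s y ≠ 0) ∧ (∀ y, 0 ≤ q y) ∧ ∑ y, q y = 1 ∧ (∀ x y, q (σ x y) = q y) ∧
      (∀ y, v y * Real.exp (-(R + s y)) ≤ q y) ∧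
      ∀ y, v y * Real.exp (-(Eo W (uniformInput X) ρ - ρ * R) + ρ * s y) ≤ W x₀ y := by
  have hU := isProbDist_uniformInput (X := X)
  have hρ1 : 0 < 1 + ρ := by linarith
  set α := columnMean W ρ with hα
  have hα0 : ∀ y, 0 ≤ α y := columnMean_nonneg hW ρ
  have hαpos : ∀ x y, 0 < W x y → 0 < α y := fun x y => columnMean_pos hW ρ
  have hασ : ∀ x y, α (σ x y) = α y := columnMean_perm hcol ρ
  set F := ∑ y, α y ^ (1 + ρ) with hF
  have hF0 : 0 < F := gallager_sum_pos hW hU hρ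
  have hEo : Eo W (uniformInput X) ρ = -Real.log F := rfl
  have hw0 : ∀ y, 0 ≤ W x₀ y := hW.1 x₀
  have hαsucc : ∀ y, α y ^ ρ * α y = α y ^ (1 + ρ) := fun y => by
    rw [Real.rpow_add_of_nonneg (hα0 y) zero_le_one hρ, Real.rpow_one, mul_comm]
  have hh : ∀ x y, α (σ x y) ^ ρ = α y ^ ρ := fun x y => by rw [hασ]
  have hκ : ∑ y, α y ^ ρ * W x₀ y ^ (1 / (1 + ρ)) = F := by
    rw [← sum_row_mul_eq hσ hU (fun t => t ^ (1 / (1 + ρ))) (fun y => α y ^ ρ) hh, hF]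
    exact Finset.sum_congr rfl fun y _ => hαsucc y
  have hκlog : ∑ y, α y ^ ρ * Real.log (α y) * W x₀ y ^ (1 / (1 + ρ)) =
      ∑ y, α y ^ (1 + ρ) * Real.log (α y) := by
    rw [← sum_row_mul_eq hσ hU (fun t => t ^ (1 / (1 + ρ)))
      (fun y => α y ^ ρ * Real.log (α y)) fun x y => by simp only [hασ]]
    refine Finset.sum_congr rfl fun y _ => ?_
    rw [← hαsucc]
    change _ * α y = _
    ring
  have hκw := sum_row_mul_eq hσ hU (fun t => t ^ (1 / (1 + ρ)) * Real.log t) (fun y => α y ^ ρ) hh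
  have hR := hd.unique (hasDerivAt_Eo hW hU hρ)
  change R = -(∑ y, (α y ^ (1 + ρ) * Real.log (α y) - α y ^ ρ *
    (∑ x, uniformInput X x * (W x y ^ (1 / (1 + ρ)) * Real.log (W x y))) / (1 + ρ))) / F at hR
  rw [Finset.sum_sub_distrib, ← Finset.sum_div, hκw, eq_div_iff hF0.ne'] at hR
  have hvw : ∀ y, W x₀ y ^ (1 / (1 + ρ)) * α y ^ ρ / F ≠ 0 → 0 < W x₀ y := by
    intro y h
    refine (hw0 y).lt_of_ne' fun h0 => h ?_
    rw [h0, Real.zero_rpow (by positivity)]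
    simp
  have hwexp : ∀ y, 0 < W x₀ y →
      W x₀ y ^ (1 / (1 + ρ)) = Real.exp (Real.log (W x₀ y) / (1 + ρ)) := fun y h => by
    rw [Real.rpow_def_of_pos h, mul_one_div]
  have hv0 : ∀ y, 0 ≤ W x₀ y ^ (1 / (1 + ρ)) * α y ^ ρ / F := fun y =>
    div_nonneg (mul_nonneg (Real.rpow_nonneg (hw0 y) _) (Real.rpow_nonneg (hα0 y) _)) hF0.le
  have hvexp : ∀ y, 0 < W x₀ y → W x₀ y ^ (1 / (1 + ρ)) * α y ^ ρ / F =
      Real.exp (Real.log (W x₀ y) / (1 + ρ) + ρ * Real.log (α y) - Real.log F) := fun y h => by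
    rw [hwexp y h, Real.rpow_def_of_pos (hαpos x₀ y h), Real.exp_sub, Real.exp_add,
      Real.exp_log hF0, mul_comm (Real.log (α y))]
  refine ⟨fun y => W x₀ y ^ (1 / (1 + ρ)) * α y ^ ρ / F,
    fun y => Real.log (W x₀ y) / (1 + ρ) - Real.log (α y) - R, fun y => α y ^ (1 + ρ) / F,
    hv0, ?_, ?_, ?_, fun y => div_nonneg (Real.rpow_nonneg (hα0 y) _) hF0.le, ?_,
    fun x y => by simp only [hασ], fun y => ?_, fun y => ?_⟩
  · rw [← Finset.sum_div, div_eq_one_iff_eq hF0.ne', ← hκ]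
    exact Finset.sum_congr rfl fun y _ => mul_comm _ _
  · have e : ∀ y, W x₀ y ^ (1 / (1 + ρ)) * α y ^ ρ / F *
        (Real.log (W x₀ y) / (1 + ρ) - Real.log (α y) - R) =
        (α y ^ ρ * (W x₀ y ^ (1 / (1 + ρ)) * Real.log (W x₀ y)) / (1 + ρ) -
          α y ^ ρ * Real.log (α y) * W x₀ y ^ (1 / (1 + ρ)) -
          α y ^ ρ * W x₀ y ^ (1 / (1 + ρ)) * R) / F := fun y => by ring
    simp only [e]
    rw [← Finset.sum_div, Finset.sum_sub_distrib, Finset.sum_sub_distrib, ← Finset.sum_div,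
      ← Finset.sum_mul, hκ, hκlog, div_eq_zero_iff]
    left
    linarith
  · by_contra! hcon
    refine hns fun x z y hxz => ?_
    have hlog : ∀ x, 0 < W x y → Real.log (W x y) = (1 + ρ) * (Real.log (α y) + R) := by
      intro x hx
      obtain ⟨y', rfl⟩ := (σ x).surjective y
      rw [hσ] at hx
      have h := hcon y' (by rw [hvexp y' hx]; exact Real.exp_pos _)
      rw [hσ, hασ]
      field_simp at h
      linarith
    have hx : 0 < W x y := (hW.1 x y).lt_of_ne' (left_ne_zero_of_mul hxz.ne')
    have hz : 0 < W z y := (hW.1 z y).lt_of_ne' (right_ne_zero_of_mul hxz.ne')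
    exact Real.log_injOn_pos hx hz ((hlog x hx).trans (hlog z hz).symm)
  · rw [← Finset.sum_div, div_self hF0.ne']
  · beta_reduce
    rcases eq_or_ne (W x₀ y ^ (1 / (1 + ρ)) * α y ^ ρ / F) 0 with h | h
    · rw [h, zero_mul]
      exact div_nonneg (Real.rpow_nonneg (hα0 y) _) hF0.le
    · have hw := hvw y h
      have hq : α y ^ (1 + ρ) / F = Real.exp (Real.log (α y) * (1 + ρ) - Real.log F) := by
        rw [Real.rpow_def_of_pos (hαpos x₀ y hw), Real.exp_sub, Real.exp_log hF0]
      rw [hvexp y hw, ← Real.exp_add, hq]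
      exact (congrArg Real.exp (by ring)).le
  · beta_reduce
    rcases eq_or_ne (W x₀ y ^ (1 / (1 + ρ)) * α y ^ ρ / F) 0 with h | h
    · rw [h, zero_mul]
      exact hw0 y
    · have hw := hvw y h
      rw [hvexp y hw, ← Real.exp_add, hEo]
      refine ((congrArg Real.exp ?_).trans (Real.exp_log hw)).le
      field_simp
      ring

end TiltedChannel

/-- **Theorem 1(ii)** (nonsingular converse with feedback): for a symmetric nonsingular DMC with
`R_cr < C(W)` and any rate `R_∞ < R < C(W)`, there is a constant `K̃₁ > 0` such that for every
blocklength `N ≥ 1`, every `(N,R)` code with ideal feedback has average error probability at least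
`K̃₁ · N^{-(1+|E_SP'(R)|)/2} · exp(-N E_SP(R))`. -/
theorem statement1 {X Y : Type} [Fintype X] [Fintype Y] [Nonempty X] [Nonempty Y]
    (W : X → Y → ℝ) (hW : IsDMC W) (hsym : GallagerSymmetric W) (hns : ¬ Singular W)
    (hcr : Rcr W < capacity W)
    (R : ℝ) (hR1 : Rinf W < R) (hR2 : R < capacity W)
    (ESP' : ℝ) (hESP' : HasDerivAt (ESP W) ESP' R) :
    ∃ K₁ : ℝ, 0 < K₁ ∧ ∀ N : ℕ, 0 < N →
      ∀ (f : Fin (Mof N R) → (Fin N → Y) → Fin N → X) (φ : (Fin N → Y) → Fin (Mof N R)),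
        Causal f →
          K₁ * (N : ℝ) ^ (-(1 + |ESP'|) / 2) * Real.exp (-(N : ℝ) * ESP W R) ≤
            avgErrorProbFb W f φ := by
  classical
  obtain ⟨ρ, hρ, hd, hE⟩ := exists_critical_parameter hW hsym hR1 hR2
  have hρ' : |ESP'| = ρ := by
    rw [hasDerivAt_ESP_unique hW hR1 isProbDist_uniformInput hρ.le hE hESP', abs_neg,
      abs_of_pos hρ]
  obtain ⟨σ, hσ, hcol⟩ := hsym.exists_perm (Classical.arbitrary X)
  obtain ⟨v, s, q, hv0, hv, hs, hne, hq0, hqsum, hqσ, hvq, hvw⟩ :=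
    exists_tilted_row hW hns hσ hcol hρ.le hd
  rw [← hE] at hvw
  obtain ⟨K, hK, hbound⟩ := sphere_packing_product_lower_bound hv0 hv hs hne hρ.le hq0 hvq
    (hW.1 (Classical.arbitrary X)) hvw
  refine ⟨K, hK, fun N hN f φ hf => ?_⟩
  obtain ⟨D, hD, herr⟩ := exists_decoding_regions hσ hqσ hf φ
  rw [hρ', ← herr]
  exact hbound N hN (Mof N R) (Nat.le_ceil _) D (by rw [hD, hqsum, one_pow])
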